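/- Let (Ω,Σ,Pr) be a probability space, A_i ∈ Σ for i ∈ ℕ, and suppose S_l ∈ [0,∞) for all l ∈ ℕ and the identity Pr(⋃_{i₁<…<i_m} (A_{i₁}∩…∩A_{i_m})) = Σ_{j=0}^∞ (-1)^j C(j+m-1, m-1) S_{j+m} holds for some m > 1. Then the analogous identity holds for every k with 1 ≤ k ≤ m-1. -/

import Mathlib

open MeasureTheory Filter ENNReal

noncomputable def S {Ω : Type*} [MeasurableSpace Ω] (μ : Measure Ω) (A : ℕ → Set Ω) (k : ℕ) :
    ℝ≥0∞ :=
  ∑' s : {s : Finset ℕ // s.card = k}, μ (⋂ i ∈ (s : Finset ℕ), A i)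

def unionInter {Ω : Type*} (A : ℕ → Set Ω) (k : ℕ) : Set Ω :=
  ⋃ s : {s : Finset ℕ // s.card = k}, ⋂ i ∈ (s : Finset ℕ), A i

def RR (K M N : ℕ) : ℕ :=
  ∑ r ∈ Finset.range N, if K + 1 ≤ r then r.choose K * (r - (K + 1)).choose M else 0

lemma alt_aux (t M : ℕ) : ∑ j ∈ Finset.range (M + 1), (-1 : ℝ) ^ j * ((t + 1).choose j : ℝ)
    = (-1) ^ M * (t.choose M : ℝ) := by
  induction M with
  | zero => simp
  | succ M ih =>
    rw [Finset.sum_range_succ, ih, Nat.choose_succ_succ]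
    push_cast
    ring

lemma alt_aux0 (M : ℕ) : ∑ j ∈ Finset.range (M + 1), (-1 : ℝ) ^ j * ((0).choose j : ℝ) = 1 := by
  induction M with
  | zero => simp
  | succ M ih =>
    rw [Finset.sum_range_succ, ih]
    simp

lemma step_aux (K M N : ℕ) :
    ∑ j ∈ Finset.range (M + 1), (-1 : ℝ) ^ j * ((j + K).choose K) * (N.choose (j + K) : ℝ)
    = (if N = K then 1 else 0) + (-1) ^ M *
      ((if K + 1 ≤ N then N.choose K * (N - (K + 1)).choose M else 0 : ℕ) : ℝ) := by
  rcases lt_or_ge N K with h | h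
  · rw [Finset.sum_eq_zero]
    · rw [if_neg (by omega), if_neg (by omega)]; simp
    · intro j _
      rw [Nat.choose_eq_zero_of_lt (show N < j + K by omega)]; simp
  have h1 : ∀ j, (-1 : ℝ) ^ j * ((j + K).choose K) * (N.choose (j + K) : ℝ)
      = N.choose K * ((-1 : ℝ) ^ j * ((N - K).choose j)) := by
    intro j
    have : N.choose (j + K) * (j + K).choose K = N.choose K * (N - K).choose j := by
      rcases le_or_gt (j + K) N with h2 | h2
      · rw [Nat.choose_mul (show K ≤ j + K by omega)]; simp
      · rw [Nat.choose_eq_zero_of_lt h2, Nat.choose_eq_zero_of_lt (show N - K < j by omega)]; simp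
    have h3 : (N.choose (j + K) : ℝ) * (j + K).choose K = N.choose K * (N - K).choose j := by
      exact_mod_cast this
    linear_combination (-1 : ℝ) ^ j * h3
  simp_rw [h1]
  rw [← Finset.mul_sum]
  rcases Nat.eq_or_lt_of_le h with h2 | h2
  · subst h2
    rw [Nat.sub_self, alt_aux0]; simp
  · obtain ⟨t, rfl⟩ := Nat.exists_eq_add_of_lt h2
    rw [show K + t + 1 - K = t + 1 by omega, alt_aux, if_neg (by omega), if_pos (by omega),
      show K + t + 1 - (K + 1) = t by omega]
    push_cast
    ring

lemma point (K M N : ℕ) :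
    ∑ j ∈ Finset.range (M + 1), (-1 : ℝ) ^ j * ((j + K).choose K) * (N.choose (j + K + 1) : ℝ)
    = (if K + 1 ≤ N then 1 else 0) + (-1) ^ M * (RR K M N : ℝ) := by
  induction N with
  | zero => simp [RR]
  | succ N ih =>
    have : RR K M (N + 1) = RR K M N +
        (if K + 1 ≤ N then N.choose K * (N - (K + 1)).choose M else 0) := by
      rw [RR, Finset.sum_range_succ, RR]
    rw [this]
    simp_rw [Nat.choose_succ_succ N]
    push_cast [mul_add, Finset.sum_add_distrib]
    rw [ih]
    have := step_aux K M N
    rw [this]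
    push_cast
    have e : (if K ≤ N then 1 else 0 : ℝ) =
        (if N = K then 1 else 0) + (if K + 1 ≤ N then 1 else 0) := by
      split_ifs <;> first | omega | norm_num
    rw [e]
    ring

lemma compare (K M N : ℕ) : (M + 1) * RR K (M + 1) N ≤ (K + 1) * RR (K + 1) M N := by
  unfold RR
  rw [Finset.mul_sum, Finset.mul_sum]
  apply Finset.sum_le_sum
  intro r _
  rcases lt_trichotomy r (K + 1) with h | h | h
  · rw [if_neg (by omega)]; simp
  · subst h; simp
  · obtain ⟨t, rfl⟩ := Nat.exists_eq_add_of_lt h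
    rw [if_pos (by omega), if_pos (by omega), show K + 1 + t + 1 - (K + 1) = t + 1 by omega,
      show K + 1 + t + 1 - (K + 1 + 1) = t by omega]
    have h1 := Nat.add_one_mul_choose_eq t M
    have h2 := Nat.choose_succ_right_eq (K + 1 + t + 1) K
    rw [show K + 1 + t + 1 - K = t + 2 by omega] at h2
    calc _ = (K + 1 + t + 1).choose K * ((t + 1).choose (M + 1) * (M + 1)) := by ring
      _ = ((K + 1 + t + 1).choose K * (t + 1)) * t.choose M := by rw [← h1]; ring
      _ ≤ ((K + 1 + t + 1).choose K * (t + 2)) * t.choose M := by gcongr; omega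
      _ = _ := by rw [← h2]; ring

lemma tsum_ind {Ω : Type*} (A : ℕ → Set Ω) (x : Ω) (hx : {i | x ∈ A i}.Finite) (l : ℕ) :
    ∑' s : {s : Finset ℕ // s.card = l}, (⋂ i ∈ (s : Finset ℕ), A i).indicator (1 : Ω → ℝ≥0∞) x
      = ({i | x ∈ A i}.ncard.choose l : ℕ) := by
  classical
  have hcard : {i | x ∈ A i}.ncard = hx.toFinset.card := Set.ncard_eq_toFinset_card _ hx
  have h1 : ∀ s : Finset ℕ, (⋂ i ∈ s, A i).indicator (1 : Ω → ℝ≥0∞) x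
      = if s ⊆ hx.toFinset then 1 else 0 := by
    intro s
    rw [Set.indicator_apply]
    congr 1
    simp [Finset.subset_iff]
  simp_rw [h1]
  rw [hcard, ← Finset.card_powersetCard]
  have h2 := tsum_subtype {s : Finset ℕ | s.card = l}
    (fun s => if s ⊆ hx.toFinset then (1 : ℝ≥0∞) else 0)
  refine h2.trans ?_
  rw [tsum_eq_sum (s := Finset.powersetCard l hx.toFinset)]
  · rw [Finset.sum_congr rfl (g := fun _ => (1 : ℝ≥0∞))]
    · simp
    · intro s hs
      rw [Finset.mem_powersetCard] at hs
      rw [Set.indicator_of_mem (show s ∈ {s : Finset ℕ | s.card = l} from hs.2), if_pos hs.1]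
  · intro s hs
    rw [Finset.mem_powersetCard] at hs
    simp only [Set.indicator_apply, Set.mem_setOf_eq]
    split_ifs <;> tauto

lemma mem_unionInter_iff {Ω : Type*} (A : ℕ → Set Ω) (x : Ω) (hx : {i | x ∈ A i}.Finite) (l : ℕ) :
    x ∈ unionInter A l ↔ l ≤ {i | x ∈ A i}.ncard := by
  have hcard : {i | x ∈ A i}.ncard = hx.toFinset.card := Set.ncard_eq_toFinset_card _ hx
  rw [hcard, Finset.le_card_iff_exists_subset_card]
  simp only [unionInter, Set.mem_iUnion, Set.mem_iInter, Subtype.exists, Finset.subset_iff,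
    Set.Finite.mem_toFinset, Set.mem_setOf_eq, exists_prop]
  tauto

section
variable {Ω : Type*} [MeasurableSpace Ω] (μ : Measure Ω) [IsProbabilityMeasure μ]
    (A : ℕ → Set Ω)

lemma ae_fin (h1 : S μ A 1 ≠ ∞) : ∀ᵐ x ∂μ, {i | x ∈ A i}.Finite := by
  apply ae_finite_setOf_mem
  refine ne_top_of_le_ne_top h1 ?_
  have := ENNReal.tsum_comp_le_tsum_of_injective
    (f := fun i : ℕ => (⟨{i}, by simp⟩ : {s : Finset ℕ // s.card = 1}))
    (fun i j h => by simpa using h) (fun s => μ (⋂ i ∈ (s : Finset ℕ), A i))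
  simpa [S] using this

lemma meas_inter (hA : ∀ i, MeasurableSet (A i)) (s : Finset ℕ) :
    MeasurableSet (⋂ i ∈ s, A i) :=
  Finset.measurableSet_biInter s (fun i _ => hA i)

lemma S_integral (hA : ∀ i, MeasurableSet (A i)) (h1 : S μ A 1 ≠ ∞) (l : ℕ) (hl : S μ A l ≠ ∞) :
    Integrable (fun x => ({i | x ∈ A i}.ncard.choose l : ℝ)) μ ∧
    (S μ A l).toReal = ∫ x, ({i | x ∈ A i}.ncard.choose l : ℝ) ∂μ := by
  set c : Ω → ℝ≥0∞ := fun x => ∑' s : {s : Finset ℕ // s.card = l},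
    (⋂ i ∈ (s : Finset ℕ), A i).indicator (1 : Ω → ℝ≥0∞) x with hc
  have hm : ∀ s : {s : Finset ℕ // s.card = l},
      Measurable ((⋂ i ∈ (s : Finset ℕ), A i).indicator (1 : Ω → ℝ≥0∞)) := fun s =>
    measurable_one.indicator (meas_inter A hA s)
  have hcm : Measurable c := Measurable.ennreal_tsum hm
  have hS : ∫⁻ x, c x ∂μ = S μ A l := by
    rw [hc, lintegral_tsum (fun s => (hm s).aemeasurable), S]
    congr 1
    ext s
    rw [lintegral_indicator_one (meas_inter A hA s)]
  have hae : (fun x => (c x).toReal) =ᵐ[μ] (fun x => ({i | x ∈ A i}.ncard.choose l : ℝ)) := by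
    filter_upwards [ae_fin μ A h1] with x hx
    simp only [hc]
    rw [tsum_ind A x hx]
    simp
  constructor
  · exact (integrable_toReal_of_lintegral_ne_top hcm.aemeasurable (by rwa [hS])).congr hae
  · rw [← integral_congr_ae hae, integral_toReal hcm.aemeasurable
      (ae_lt_top hcm (by rwa [hS])), hS]

lemma U_integral (hA : ∀ i, MeasurableSet (A i)) (h1 : S μ A 1 ≠ ∞) (l : ℕ) :
    Integrable (fun x => if l ≤ {i | x ∈ A i}.ncard then (1 : ℝ) else 0) μ ∧
    (μ (unionInter A l)).toReal = ∫ x, (if l ≤ {i | x ∈ A i}.ncard then (1 : ℝ) else 0) ∂μ := by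
  have hU : MeasurableSet (unionInter A l) :=
    MeasurableSet.iUnion (fun s => meas_inter A hA s)
  have hae : (unionInter A l).indicator (1 : Ω → ℝ) =ᵐ[μ]
      (fun x => if l ≤ {i | x ∈ A i}.ncard then (1 : ℝ) else 0) := by
    filter_upwards [ae_fin μ A h1] with x hx
    classical
    rw [Set.indicator_apply]
    simp only [mem_unionInter_iff A x hx, Pi.one_apply]
  constructor
  · exact ((integrable_const (1 : ℝ)).indicator hU).congr hae
  · rw [← integral_congr_ae hae, integral_indicator_one hU]; rfl

lemma main_id (hA : ∀ i, MeasurableSet (A i)) (hfin : ∀ l, 1 ≤ l → S μ A l ≠ ∞) (K M : ℕ) :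
    Integrable (fun x => (RR K M {i | x ∈ A i}.ncard : ℝ)) μ ∧
    ∑ j ∈ Finset.range (M + 1), (-1 : ℝ) ^ j * ((j + K).choose K) * (S μ A (j + K + 1)).toReal
      = (μ (unionInter A (K + 1))).toReal +
        (-1) ^ M * ∫ x, (RR K M {i | x ∈ A i}.ncard : ℝ) ∂μ := by
  have h1 := hfin 1 le_rfl
  have hT : ∀ j ∈ Finset.range (M + 1), Integrable (fun x => (-1 : ℝ) ^ j * ((j + K).choose K) *
      ({i | x ∈ A i}.ncard.choose (j + K + 1) : ℝ)) μ := fun j _ =>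
    (S_integral μ A hA h1 (j + K + 1) (hfin _ (by omega))).1.const_mul _
  obtain ⟨hU, hU2⟩ := U_integral μ A hA h1 (K + 1)
  have hsq : (-1 : ℝ) ^ M * (-1) ^ M = 1 := by rw [← mul_pow]; simp
  have hR : Integrable (fun x => (RR K M {i | x ∈ A i}.ncard : ℝ)) μ := by
    refine (((integrable_finset_sum _ hT).sub hU).const_mul ((-1 : ℝ) ^ M)).congr ?_
    refine Eventually.of_forall fun x => ?_
    have := point K M {i | x ∈ A i}.ncard
    simp only [Pi.sub_apply]
    rw [this]
    linear_combination (RR K M {i | x ∈ A i}.ncard : ℝ) * hsq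
  refine ⟨hR, ?_⟩
  rw [hU2, ← integral_const_mul, ← integral_add hU (hR.const_mul _)]
  simp_rw [← point]
  rw [integral_finset_sum _ hT]
  refine Finset.sum_congr rfl fun j _ => ?_
  rw [integral_const_mul, (S_integral μ A hA h1 (j + K + 1) (hfin _ (by omega))).2]

/-- The identity for `k = K + 1` amounts to the vanishing of the expected remainder. -/
lemma tendsto_iff (hA : ∀ i, MeasurableSet (A i)) (hfin : ∀ l, 1 ≤ l → S μ A l ≠ ∞) (K : ℕ) :
    Tendsto (fun n => ∑ j ∈ Finset.range n,
        (-1 : ℝ) ^ j * ((j + K).choose K) * (S μ A (j + K + 1)).toReal)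
      atTop (nhds (μ (unionInter A (K + 1))).toReal) ↔
    Tendsto (fun M => ∫ x, (RR K M {i | x ∈ A i}.ncard : ℝ) ∂μ) atTop (nhds 0) := by
  rw [← tendsto_add_atTop_iff_nat 1]
  simp_rw [(main_id μ A hA hfin K _).2]
  rw [← tendsto_sub_nhds_zero_iff, tendsto_zero_iff_abs_tendsto_zero,
    tendsto_zero_iff_abs_tendsto_zero (f := fun M => ∫ x, (RR K M {i | x ∈ A i}.ncard : ℝ) ∂μ)]
  have : (abs ∘ fun x : ℕ => (μ (unionInter A (K + 1))).toReal +
      (-1) ^ x * ∫ y, (RR K x {i | y ∈ A i}.ncard : ℝ) ∂μ - (μ (unionInter A (K + 1))).toReal)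
      = (abs ∘ fun M => ∫ x, (RR K M {i | x ∈ A i}.ncard : ℝ) ∂μ) := by
    ext M
    simp [abs_mul]
  rw [this]

lemma descend (hA : ∀ i, MeasurableSet (A i)) (hfin : ∀ l, 1 ≤ l → S μ A l ≠ ∞) (K : ℕ)
    (h : Tendsto (fun M => ∫ x, (RR (K + 1) M {i | x ∈ A i}.ncard : ℝ) ∂μ) atTop (nhds 0)) :
    Tendsto (fun M => ∫ x, (RR K M {i | x ∈ A i}.ncard : ℝ) ∂μ) atTop (nhds 0) := by
  rw [← tendsto_add_atTop_iff_nat 1]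
  refine squeeze_zero (fun M => integral_nonneg fun x => Nat.cast_nonneg _) (fun M => ?_)
    (by simpa using h.const_mul ((K : ℝ) + 1))
  rw [← integral_const_mul]
  refine integral_mono (main_id μ A hA hfin K (M + 1)).1
    ((main_id μ A hA hfin (K + 1) M).1.const_mul _) fun x => ?_
  have h1 := compare K M {i | x ∈ A i}.ncard
  have h2 : RR K (M + 1) {i | x ∈ A i}.ncard ≤ (K + 1) * RR (K + 1) M {i | x ∈ A i}.ncard := by
    nlinarith
  have h3 : (RR K (M + 1) {i | x ∈ A i}.ncard : ℝ) ≤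
      ((K : ℝ) + 1) * (RR (K + 1) M {i | x ∈ A i}.ncard : ℝ) := by
    have := (Nat.cast_le (α := ℝ)).2 h2
    push_cast at this
    exact this
  exact h3

end

/-- Corollary 2.2: if all `S_l` are finite and the generalized inclusion-exclusion
identity holds for some `m > 1`, then it holds for every `k` with `1 ≤ k ≤ m - 1`. -/
theorem stmt4 {Ω : Type*} [MeasurableSpace Ω] (μ : Measure Ω) [IsProbabilityMeasure μ]
    (A : ℕ → Set Ω) (hA : ∀ i, MeasurableSet (A i))
    (hfin : ∀ l, 1 ≤ l → S μ A l ≠ ∞) (m : ℕ) (hm : 1 < m)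
    (hid : Tendsto (fun n => ∑ j ∈ Finset.range n,
        (-1 : ℝ) ^ j * (Nat.choose (j + m - 1) (m - 1)) * (S μ A (j + m)).toReal)
      atTop (nhds (μ (unionInter A m)).toReal)) :
    ∀ k, 1 ≤ k → k ≤ m - 1 →
      Tendsto (fun n => ∑ j ∈ Finset.range n,
          (-1 : ℝ) ^ j * (Nat.choose (j + k - 1) (k - 1)) * (S μ A (j + k)).toReal)
        atTop (nhds (μ (unionInter A k)).toReal) := by
  intro k hk hkm
  obtain ⟨L, rfl⟩ : ∃ L, m = L + 1 := ⟨m - 1, by omega⟩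
  obtain ⟨K, rfl⟩ : ∃ K, k = K + 1 := ⟨k - 1, by omega⟩
  have h1 := (tendsto_iff μ A hA hfin L).1 hid
  refine (tendsto_iff μ A hA hfin K).2 ?_
  have hKL : K ≤ L := by omega
  clear hid hm hkm hk
  induction L, hKL using Nat.le_induction with
  | base => exact h1
  | succ n _ ih => exact ih (descend μ A hA hfin n h1)
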